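/- Let (Ω, μ) be a probability space, M a fixed real l×k matrix with orthonormal columns (Mᵀ M = I_k), and G : Ω → ℝ^{l×m} a measurable random matrix with ‖G(ω)‖_F ≤ ρ almost everywhere. Define the subspace concentration ratio χ(ω) = ‖Mᵀ G(ω)‖_F / ‖G(ω)‖_F when G(ω) ≠ 0 and χ(ω) = 1 when G(ω) = 0. If 𝔼[χ²] ≥ δ² for some δ ∈ [0, 1], then the expected squared reconstruction error satisfies 𝔼[‖G − M (Mᵀ G)‖_F²] ≤ (1 − δ²) ρ². -/

import Mathlib

open Matrix MeasureTheory

/-- Frobenius norm of a real matrix: `‖X‖_F = sqrt (Tr (Xᵀ X))`. -/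
noncomputable def frobNorm {l m : ℕ} (X : Matrix (Fin l) (Fin m) ℝ) : ℝ :=
  Real.sqrt (Matrix.trace (Xᵀ * X))

theorem frobNorm_sq {l m : ℕ} (X : Matrix (Fin l) (Fin m) ℝ) :
    frobNorm X ^ 2 = Matrix.trace (Xᵀ * X) :=
  Real.sq_sqrt (by simpa using (Matrix.posSemidef_conjTranspose_mul_self X).trace_nonneg)

theorem frobNorm_ne_zero {l m : ℕ} {X : Matrix (Fin l) (Fin m) ℝ} (hX : X ≠ 0) :
    frobNorm X ≠ 0 := by
  intro h
  have htrace := frobNorm_sq X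
  rw [h, zero_pow two_ne_zero, ← Matrix.conjTranspose_eq_transpose_of_trivial] at htrace
  exact hX (Matrix.trace_conjTranspose_mul_self_eq_zero_iff.mp htrace.symm)

/-- Pythagorean identity for the projection onto the column space of `M`. -/
theorem frobNorm_sub_projection_sq {l m k : ℕ} {M : Matrix (Fin l) (Fin k) ℝ}
    (hM : Mᵀ * M = 1) (X : Matrix (Fin l) (Fin m) ℝ) :
    frobNorm (X - M * (Mᵀ * X)) ^ 2 = frobNorm X ^ 2 - frobNorm (Mᵀ * X) ^ 2 := by
  have horth : Mᵀ * (X - M * (Mᵀ * X)) = 0 := by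
    rw [Matrix.mul_sub, ← Matrix.mul_assoc, hM, Matrix.one_mul, sub_self]
  have hprod : (X - M * (Mᵀ * X))ᵀ * (X - M * (Mᵀ * X)) =
      Xᵀ * X - (Mᵀ * X)ᵀ * (Mᵀ * X) := by
    rw [Matrix.transpose_sub, Matrix.transpose_mul M, Matrix.sub_mul, Matrix.mul_assoc _ Mᵀ,
      horth, Matrix.mul_zero, sub_zero, Matrix.mul_sub, Matrix.transpose_mul,
      Matrix.transpose_transpose]
    simp only [Matrix.mul_assoc]
  simp only [frobNorm_sq, hprod, Matrix.trace_sub]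

/-- Per-client bound of Theorem 1: if the random gradient matrix `G` satisfies
`‖G‖_F ≤ ρ` a.e. and the expected squared subspace concentration ratio onto the
basis `M` is at least `δ²`, then `𝔼[‖G − M (Mᵀ G)‖_F²] ≤ (1 − δ²) ρ²`. -/
theorem expected_reconstruction_error_bound {l m k : ℕ}
    {Ω : Type*} [MeasurableSpace Ω] (μ : Measure Ω) [IsProbabilityMeasure μ]
    (M : Matrix (Fin l) (Fin k) ℝ) (hM : Mᵀ * M = 1)
    (G : Ω → Matrix (Fin l) (Fin m) ℝ)
    (hGmeas : ∀ (i : Fin l) (j : Fin m), Measurable fun ω => G ω i j)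
    (ρ δ : ℝ) (hδ0 : 0 ≤ δ) (hδ1 : δ ≤ 1)
    (hbound : ∀ᵐ ω ∂μ, frobNorm (G ω) ≤ ρ)
    (χ : Ω → ℝ)
    (hχ : ∀ ω, χ ω =
      if G ω = 0 then 1 else frobNorm (Mᵀ * G ω) / frobNorm (G ω))
    (hconc : δ ^ 2 ≤ ∫ ω, χ ω ^ 2 ∂μ) :
    ∫ ω, frobNorm (G ω - M * (Mᵀ * G ω)) ^ 2 ∂μ ≤ (1 - δ ^ 2) * ρ ^ 2 := by
  have hsq : ∀ᵐ ω ∂μ, frobNorm (G ω) ^ 2 ≤ ρ ^ 2 := by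
    filter_upwards [hbound] with ω hω
    exact pow_le_pow_left₀ (Real.sqrt_nonneg _) hω 2
  have herr_nonneg : 0 ≤ᵐ[μ] fun ω => frobNorm (G ω - M * (Mᵀ * G ω)) ^ 2 :=
    .of_forall fun ω => sq_nonneg _
  have herr : ∀ᵐ ω ∂μ,
      frobNorm (G ω - M * (Mᵀ * G ω)) ^ 2 ≤ (1 - χ ω ^ 2) * ρ ^ 2 := by
    filter_upwards [hsq] with ω hω
    by_cases hG : G ω = 0
    · simp [hχ, hG, frobNorm]
    · have hpos : 0 < frobNorm (G ω) ^ 2 := by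
        have := frobNorm_ne_zero hG
        positivity
      have heq : frobNorm (G ω - M * (Mᵀ * G ω)) ^ 2 =
          (1 - χ ω ^ 2) * frobNorm (G ω) ^ 2 := by
        rw [frobNorm_sub_projection_sq hM, hχ, if_neg hG, div_pow, sub_mul, one_mul,
          div_mul_cancel₀ _ hpos.ne']
      have hχ_le : 0 ≤ 1 - χ ω ^ 2 :=
        nonneg_of_mul_nonneg_left (heq ▸ sq_nonneg _) hpos
      rw [heq]
      exact mul_le_mul_of_nonneg_left hω hχ_le
  by_cases hint : Integrable (fun ω => χ ω ^ 2) μ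
  · calc
      ∫ ω, frobNorm (G ω - M * (Mᵀ * G ω)) ^ 2 ∂μ ≤ ∫ ω, (1 - χ ω ^ 2) * ρ ^ 2 ∂μ :=
        integral_mono_of_nonneg herr_nonneg
          (((integrable_const 1).sub hint).mul_const _) herr
      _ = (1 - ∫ ω, χ ω ^ 2 ∂μ) * ρ ^ 2 := by
        rw [integral_mul_const, integral_sub (integrable_const 1) hint]
        simp
      _ ≤ (1 - δ ^ 2) * ρ ^ 2 := by gcongr
  · rw [integral_undef hint] at hconc
    calc
      ∫ ω, frobNorm (G ω - M * (Mᵀ * G ω)) ^ 2 ∂μ ≤ ∫ _, ρ ^ 2 ∂μ := by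
        refine integral_mono_of_nonneg herr_nonneg (integrable_const _) ?_
        filter_upwards [herr] with ω hω
        nlinarith [mul_nonneg (sq_nonneg (χ ω)) (sq_nonneg ρ)]
      _ = ρ ^ 2 := by simp
      _ ≤ (1 - δ ^ 2) * ρ ^ 2 := by nlinarith [sq_nonneg ρ]
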